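/- Assume R1 ≠ R2, ‖R1‖ ≤ 1, ‖R2‖ ≤ 1, and Ω > 0. Define μ1 = 2·√(2/(S·(S+T)³))·Rbx²·Rx·Rm, μ2 = (2/(S+T))·Rbx·Rx, μ3 = √(2/(S·(S+T)))·Rbx·Rm, and s1 = ((S+T)² − 4·Rbx²·Rx²)/√(2·S·(S+T)³). Then 0 ≤ μ2 ≤ 1, 0 ≤ μ3 ≤ 1, 0 ≤ s1 ≤ 1, μ1 = μ2·μ3, and s1² = (1 − μ2²)·(1 − μ3²). (These conditions make the affine map D, which contracts the x-, y-, z-Bloch components by μ1, μ2, μ3 and translates by s1 along x, an extremal completely positive trace-preserving qubit map.) -/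

import Mathlib

noncomputable section

open Real

/-- Euclidean dot product on ℝ³ (vectors as `Fin 3 → ℝ`). -/
def dot3 (v w : Fin 3 → ℝ) : ℝ := v 0 * w 0 + v 1 * w 1 + v 2 * w 2

/-- Cross product on ℝ³. -/
def cross3 (v w : Fin 3 → ℝ) : Fin 3 → ℝ :=
  ![v 1 * w 2 - v 2 * w 1, v 2 * w 0 - v 0 * w 2, v 0 * w 1 - v 1 * w 0]

/-- Euclidean norm on ℝ³. -/
def norm3 (v : Fin 3 → ℝ) : ℝ := Real.sqrt (dot3 v v)

/-- `T = Σ_{i,j∈{1,2}} (1 − Ri·Rj)(Rbi·Rbj)`. -/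
def Tq (R1 R2 Rb1 Rb2 : Fin 3 → ℝ) : ℝ :=
  (1 - dot3 R1 R1) * dot3 Rb1 Rb1 + (1 - dot3 R1 R2) * dot3 Rb1 Rb2
    + (1 - dot3 R2 R1) * dot3 Rb2 Rb1 + (1 - dot3 R2 R2) * dot3 Rb2 Rb2

/-- `S = √(T² + 4·Rbx²·(Rm² − Rx²))`. -/
def Sq (R1 R2 Rb1 Rb2 : Fin 3 → ℝ) : ℝ :=
  Real.sqrt ((Tq R1 R2 Rb1 Rb2) ^ 2
    + 4 * (norm3 (cross3 Rb1 Rb2)) ^ 2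
      * ((norm3 (R1 - R2)) ^ 2 - (norm3 (cross3 R1 R2)) ^ 2))

/-- Indicator function `Ω = S + T − 2·Rbx·Rx`. -/
def Omega (R1 R2 Rb1 Rb2 : Fin 3 → ℝ) : ℝ :=
  Sq R1 R2 Rb1 Rb2 + Tq R1 R2 Rb1 Rb2
    - 2 * norm3 (cross3 Rb1 Rb2) * norm3 (cross3 R1 R2)

/-- `Ξ = (R1·(R1−R2))(Rb1·(Rb1+Rb2)) + (R2·(R1−R2))(Rb2·(Rb1+Rb2))`. -/
def Xi (R1 R2 Rb1 Rb2 : Fin 3 → ℝ) : ℝ :=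
  dot3 R1 (R1 - R2) * dot3 Rb1 (Rb1 + Rb2) + dot3 R2 (R1 - R2) * dot3 Rb2 (Rb1 + Rb2)

/-- `ξ = Rx·Rbp² + Rbx·Rm²`. -/
def xiq (R1 R2 Rb1 Rb2 : Fin 3 → ℝ) : ℝ :=
  norm3 (cross3 R1 R2) * (norm3 (Rb1 + Rb2)) ^ 2
    + norm3 (cross3 Rb1 Rb2) * (norm3 (R1 - R2)) ^ 2

/-- `Γ_b² = Rbp² − T + 2·Rx·Rbx`. -/
def Gb2 (R1 R2 Rb1 Rb2 : Fin 3 → ℝ) : ℝ :=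
  (norm3 (Rb1 + Rb2)) ^ 2 - Tq R1 R2 Rb1 Rb2
    + 2 * norm3 (cross3 R1 R2) * norm3 (cross3 Rb1 Rb2)

lemma dot3_self_nonneg (v : Fin 3 → ℝ) : 0 ≤ dot3 v v := by
  unfold dot3
  nlinarith [mul_self_nonneg (v 0), mul_self_nonneg (v 1), mul_self_nonneg (v 2)]

lemma norm3_nonneg (v : Fin 3 → ℝ) : 0 ≤ norm3 v := Real.sqrt_nonneg _

lemma norm3_sq (v : Fin 3 → ℝ) : norm3 v ^ 2 = dot3 v v :=
  Real.sq_sqrt (dot3_self_nonneg v)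

/-- Since `v × w = -(v × (v - w))`, its norm is at most `‖v‖ ‖v - w‖`. -/
lemma norm3_cross3_sq_le (v w : Fin 3 → ℝ) :
    norm3 (cross3 v w) ^ 2 ≤ norm3 v ^ 2 * norm3 (v - w) ^ 2 := by
  have lagrange : norm3 v ^ 2 * norm3 (v - w) ^ 2
      = norm3 (cross3 v w) ^ 2 + dot3 v (v - w) ^ 2 := by
    simp only [norm3_sq, dot3, cross3, Pi.sub_apply, Matrix.cons_val]
    ring
  rw [lagrange]
  linarith [sq_nonneg (dot3 v (v - w))]

lemma norm3_cross3_sq_le_of_norm3_le_one {v : Fin 3 → ℝ} (hv : norm3 v ≤ 1) (w : Fin 3 → ℝ) :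
    norm3 (cross3 v w) ^ 2 ≤ norm3 (v - w) ^ 2 :=
  (norm3_cross3_sq_le v w).trans
    (mul_le_of_le_one_left (sq_nonneg _) (pow_le_one₀ (norm3_nonneg v) hv))

/-- The scalar form of the extremality conditions. -/
lemma extremal_parameters {S T B X M : ℝ} (hB : 0 ≤ B) (hX : 0 ≤ X) (hM : 0 ≤ M)
    (hS : 0 < S) (hS2 : S ^ 2 = T ^ 2 + 4 * B ^ 2 * (M ^ 2 - X ^ 2))
    (hpos : 2 * B * X < S + T) {μ1 μ2 μ3 s1 : ℝ}
    (hμ1 : μ1 = 2 * √(2 / (S * (S + T) ^ 3)) * B ^ 2 * X * M)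
    (hμ2 : μ2 = 2 / (S + T) * (B * X))
    (hμ3 : μ3 = √(2 / (S * (S + T))) * (B * M))
    (hs1 : s1 = ((S + T) ^ 2 - 4 * B ^ 2 * X ^ 2) / √(2 * S * (S + T) ^ 3)) :
    (0 ≤ μ2 ∧ μ2 ≤ 1) ∧ (0 ≤ μ3 ∧ μ3 ≤ 1) ∧ (0 ≤ s1 ∧ s1 ≤ 1) ∧
    μ1 = μ2 * μ3 ∧ s1 ^ 2 = (1 - μ2 ^ 2) * (1 - μ3 ^ 2) := by
  have hBX : 0 ≤ B * X := mul_nonneg hB hX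
  obtain ⟨P, hP⟩ : ∃ P, P = S + T := ⟨_, rfl⟩
  rw [← hP] at hμ1 hμ2 hμ3 hs1 hpos
  have hP0 : 0 < P := by linarith
  have hN : 0 ≤ P ^ 2 - 4 * B ^ 2 * X ^ 2 := by nlinarith
  have hBM : 4 * (B * M) ^ 2 = 2 * S * P - (P ^ 2 - 4 * B ^ 2 * X ^ 2) := by
    subst hP
    linear_combination -hS2
  have hμ2_nonneg : 0 ≤ μ2 := by rw [hμ2]; positivity
  have hμ3_nonneg : 0 ≤ μ3 := by rw [hμ3]; positivity
  have hs1_nonneg : 0 ≤ s1 := by rw [hs1]; positivity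
  have hμ2_le : μ2 ≤ 1 := by
    rw [hμ2, div_mul_eq_mul_div, div_le_one hP0]
    linarith
  have hμ3_sq : 1 - μ3 ^ 2 = (P ^ 2 - 4 * B ^ 2 * X ^ 2) / (2 * S * P) := by
    rw [hμ3, mul_pow, Real.sq_sqrt (by positivity)]
    field_simp
    linear_combination -hBM
  have hμ3_compl : 0 ≤ 1 - μ3 ^ 2 := by rw [hμ3_sq]; positivity
  have hs1_sq : s1 ^ 2 = (1 - μ2 ^ 2) * (1 - μ3 ^ 2) := by
    rw [hμ3_sq, hs1, hμ2, div_pow, Real.sq_sqrt (by positivity)]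
    field_simp
    ring
  have hprod : μ1 = μ2 * μ3 := by
    have hsqrt : √(2 / (S * P ^ 3)) = √(2 / (S * P)) / P := by
      rw [show 2 / (S * P ^ 3) = 2 / (S * P) / P ^ 2 by field_simp,
        Real.sqrt_div' _ (sq_nonneg P), Real.sqrt_sq hP0.le]
    rw [hμ1, hμ2, hμ3, hsqrt]
    ring
  refine ⟨⟨hμ2_nonneg, hμ2_le⟩, ⟨hμ3_nonneg, ?_⟩, ⟨hs1_nonneg, ?_⟩, hprod, hs1_sq⟩
  · nlinarith
  · have : s1 ^ 2 ≤ 1 := by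
      rw [hs1_sq]
      exact mul_le_one₀ (by linarith [sq_nonneg μ2]) hμ3_compl (by linarith [sq_nonneg μ3])
    nlinarith

/-- for `R1 ≠ R2`, `‖R1‖ ≤ 1`, `‖R2‖ ≤ 1` and `Ω > 0`, the parameters
`μ1, μ2, μ3, s1` of the affine map `D` satisfy `0 ≤ μ2 ≤ 1`, `0 ≤ μ3 ≤ 1`,
`0 ≤ s1 ≤ 1`, `μ1 = μ2·μ3` and `s1² = (1 − μ2²)·(1 − μ3²)`. -/
theorem stmt_19 (R1 R2 Rb1 Rb2 : Fin 3 → ℝ) (hne : R1 ≠ R2)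
    (h1 : norm3 R1 ≤ 1) (h2 : norm3 R2 ≤ 1)
    (hOmega : 0 < Omega R1 R2 Rb1 Rb2)
    (μ1 μ2 μ3 s1 : ℝ)
    (hμ1 : μ1 = 2 * Real.sqrt (2 /
          (Sq R1 R2 Rb1 Rb2 * (Sq R1 R2 Rb1 Rb2 + Tq R1 R2 Rb1 Rb2) ^ 3))
        * (norm3 (cross3 Rb1 Rb2)) ^ 2 * norm3 (cross3 R1 R2) * norm3 (R1 - R2))
    (hμ2 : μ2 = 2 / (Sq R1 R2 Rb1 Rb2 + Tq R1 R2 Rb1 Rb2)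
        * (norm3 (cross3 Rb1 Rb2) * norm3 (cross3 R1 R2)))
    (hμ3 : μ3 = Real.sqrt (2 /
          (Sq R1 R2 Rb1 Rb2 * (Sq R1 R2 Rb1 Rb2 + Tq R1 R2 Rb1 Rb2)))
        * (norm3 (cross3 Rb1 Rb2) * norm3 (R1 - R2)))
    (hs1 : s1 = ((Sq R1 R2 Rb1 Rb2 + Tq R1 R2 Rb1 Rb2) ^ 2
          - 4 * (norm3 (cross3 Rb1 Rb2)) ^ 2 * (norm3 (cross3 R1 R2)) ^ 2)
        / Real.sqrt (2 * Sq R1 R2 Rb1 Rb2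
            * (Sq R1 R2 Rb1 Rb2 + Tq R1 R2 Rb1 Rb2) ^ 3)) :
    (0 ≤ μ2 ∧ μ2 ≤ 1) ∧ (0 ≤ μ3 ∧ μ3 ≤ 1) ∧ (0 ≤ s1 ∧ s1 ≤ 1) ∧
    μ1 = μ2 * μ3 ∧ s1 ^ 2 = (1 - μ2 ^ 2) * (1 - μ3 ^ 2) := by
  have hXM := norm3_cross3_sq_le_of_norm3_le_one h1 R2
  have hD : 0 ≤ 4 * norm3 (cross3 Rb1 Rb2) ^ 2
      * (norm3 (R1 - R2) ^ 2 - norm3 (cross3 R1 R2) ^ 2) :=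
    mul_nonneg (by positivity) (sub_nonneg.2 hXM)
  have hS2 := Real.sq_sqrt (add_nonneg (sq_nonneg (Tq R1 R2 Rb1 Rb2)) hD)
  change Sq R1 R2 Rb1 Rb2 ^ 2 = _ at hS2
  have hpos : 2 * norm3 (cross3 Rb1 Rb2) * norm3 (cross3 R1 R2)
      < Sq R1 R2 Rb1 Rb2 + Tq R1 R2 Rb1 Rb2 := sub_pos.1 hOmega
  have hTS : Tq R1 R2 Rb1 Rb2 ≤ Sq R1 R2 Rb1 Rb2 :=
    Real.le_sqrt_of_sq_le (le_add_of_nonneg_right hD)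
  have hBX := mul_nonneg (norm3_nonneg (cross3 Rb1 Rb2)) (norm3_nonneg (cross3 R1 R2))
  exact extremal_parameters (norm3_nonneg _) (norm3_nonneg _) (norm3_nonneg _)
    (by linarith) hS2 hpos hμ1 hμ2 hμ3 hs1
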